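/- Let a, b, c be real numbers with a, b, c ≥ 0, a + b + c = 2, and bc ≥ (1 − a)². Then the entanglement witness W̃[a,b,c] is decomposable: there exist positive semidefinite 9×9 matrices P and Q such that W̃[a,b,c] = P + Q^Γ. -/

import Mathlib

open scoped ComplexOrder

/-- The entanglement witness `W̃[a,b,c]` as a `9 × 9` matrix indexed by pairs
`(i,j)` with `i, j ∈ Fin 3`: its diagonal entries in the order
`(1,1),(1,2),(1,3),(2,1),(2,2),(2,3),(3,1),(3,2),(3,3)` are
`a/6, b/6, c/6, b/6, c/6, a/6, c/6, a/6, b/6` (i.e. the entry at `(i,j)` is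
`![a,b,c] (i+j) / 6`), and its only off-diagonal nonzero entries are
`W̃[(i,i),(j,j)] = −1/6` for `i ≠ j`. -/
noncomputable def Wt (a b c : ℝ) : Matrix (Fin 3 × Fin 3) (Fin 3 × Fin 3) ℂ :=
  Matrix.of fun p q =>
    if p = q then ((![a, b, c] (p.1 + p.2) / 6 : ℝ) : ℂ)
    else if p.2 = p.1 ∧ q.2 = q.1 then ((-1 / 6 : ℝ) : ℂ) else 0

/-- Partial transposition (with respect to the second factor):
`(X^Γ)[(i,j),(k,l)] = X[(i,l),(k,j)]`. -/
def ptrans (X : Matrix (Fin 3 × Fin 3) (Fin 3 × Fin 3) ℂ) :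
    Matrix (Fin 3 × Fin 3) (Fin 3 × Fin 3) ℂ :=
  Matrix.of fun p q => X (p.1, q.2) (q.1, p.2)

lemma form_nonneg (a d c u w : ℝ) (ha : 0 ≤ a) (hc : 0 ≤ c) (h : d ^ 2 ≤ a * c) :
    0 ≤ a * u ^ 2 + 2 * d * u * w + c * w ^ 2 := by
  rcases ha.eq_or_lt with h0 | h0
  · subst h0
    have : d = 0 := by nlinarith
    subst this
    nlinarith [mul_nonneg hc (sq_nonneg w)]
  · have h1 : 0 ≤ a * (a * u ^ 2 + 2 * d * u * w + c * w ^ 2) := by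
      nlinarith [sq_nonneg (a * u + d * w), mul_nonneg (sub_nonneg.2 h) (sq_nonneg w)]
    exact nonneg_of_mul_nonneg_right h1 h0

lemma two_psd (a d c : ℝ) (ha : 0 ≤ a) (hc : 0 ≤ c) (h : d ^ 2 ≤ a * c) :
    (!![(a : ℂ), (d : ℂ); (d : ℂ), (c : ℂ)]).PosSemidef := by
  rw [Matrix.posSemidef_iff_dotProduct_mulVec]
  constructor
  · ext i j
    fin_cases i <;> fin_cases j <;> simp
  · intro x
    rw [Complex.nonneg_iff]
    have h1 := form_nonneg a d c (x 0).re (x 1).re ha hc h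
    have h2 := form_nonneg a d c (x 0).im (x 1).im ha hc h
    simp [Matrix.mulVec, dotProduct, Fin.sum_univ_two]
    constructor
    · nlinarith
    · ring

/-- Coefficients of the two functionals `v00 - v22` and `v11 - v22`. -/
noncomputable def Bm : Matrix (Fin 2) (Fin 3 × Fin 3) ℂ :=
  Matrix.of fun i p => if p.1 = p.2 then (![![1, 0, -1], ![0, 1, -1]] i p.1 : ℂ) else 0

/-- The antisymmetric vector `e_ij - e_ji`. -/
noncomputable def av (i j : Fin 3) : Fin 3 × Fin 3 → ℂ :=
  fun p => if p = (i, j) then 1 else if p = (j, i) then -1 else 0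

lemma av_psd (t : ℝ) (ht : 0 ≤ t) (i j : Fin 3) :
    ((((t / 6 : ℝ)) : ℂ) • Matrix.vecMulVec (av i j) (star (av i j))).PosSemidef := by
  apply Matrix.PosSemidef.smul (Matrix.posSemidef_vecMulVec_self_star _)
  rw [Complex.zero_le_real]
  positivity

set_option maxHeartbeats 4000000 in
/-- for `a, b, c ≥ 0` with `a + b + c = 2` and `bc ≥ (1−a)²`,
the witness `W̃[a,b,c]` is decomposable: `W̃[a,b,c] = P + Q^Γ` with `P, Q ≥ 0`. -/
theorem stmt17 (a b c : ℝ) (ha : 0 ≤ a) (hb : 0 ≤ b) (hc : 0 ≤ c)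
    (hsum : a + b + c = 2) (hell : (1 - a) ^ 2 ≤ b * c) :
    ∃ P Q : Matrix (Fin 3 × Fin 3) (Fin 3 × Fin 3) ℂ,
      P.PosSemidef ∧ Q.PosSemidef ∧ Wt a b c = P + ptrans Q := by
  have hN := two_psd (a / 6) ((b - 1) / 6) (c / 6) (by positivity) (by positivity) (by
    have : a = 2 - b - c := by linarith
    subst this
    nlinarith)
  refine ⟨_, _, hN.conjTranspose_mul_mul_same Bm,
    ((av_psd b hb 0 1).add (av_psd c hc 0 2)).add (av_psd a ha 1 2), ?_⟩
  have hac : a = 2 - b - c := by linarith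
  subst hac
  ext ⟨i, j⟩ ⟨k, l⟩
  fin_cases i <;> fin_cases j <;> fin_cases k <;> fin_cases l <;>
    simp [Wt, ptrans, Bm, av, Matrix.mul_apply, Fin.sum_univ_two, Matrix.vecMulVec_apply] <;>
    ring
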